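/- arXiv:1810.11650 — 2 statements merged into one kernel-verified Lean document; each statement's English description precedes it below -/
import Mathlib

section
/- For real positive constants c and r, the activation function A_{N,c,r}(z) = z/(c + (√N/r)‖z‖) satisfies F_N(A_{N,c,r}(z)) = F_N(z)/(c + (1/r)‖F_N(z)‖) for every z ∈ ℂ^N. -/
open Complex Finset

/-- The discrete Fourier transform `F_N : ℂ^N → ℂ^N`,
`F_N(x)_k = ∑_j x_j ω^{jk}` with `ω = exp(-2πi/N)`. -/
noncomputable def dft (N : ℕ) (x : Fin N → ℂ) : Fin N → ℂ :=
  fun k => ∑ j : Fin N, x j * Complex.exp (-2 * Real.pi * Complex.I / N) ^ ((j : ℕ) * (k : ℕ))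

/-- The Euclidean (Hermitian) norm `‖x‖ = √(∑_j x_j conj(x_j))` on `ℂ^N`. -/
noncomputable def cnorm {N : ℕ} (x : Fin N → ℂ) : ℝ :=
  Real.sqrt (∑ j : Fin N, Complex.normSq (x j))

/-- The activation `A_{N,c,r}(z) = z / (c + (√N/r) ‖z‖)` of Georgiou et al.,
extended to `ℂ^N` so that it commutes with the DFT. -/
noncomputable def actG (N : ℕ) (c r : ℝ) (z : Fin N → ℂ) : Fin N → ℂ :=
  fun j => z j / ((c + (Real.sqrt N / r) * cnorm z : ℝ) : ℂ)

lemma IsPrimitiveRoot.sum_pow_mul_conj_pow {N : ℕ} {ζ : ℂ} (hζ : IsPrimitiveRoot ζ N)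
    (hN : N ≠ 0) (i j : Fin N) :
    ∑ k : Fin N, ζ ^ ((i : ℕ) * (k : ℕ)) * (starRingEnd ℂ) (ζ ^ ((j : ℕ) * (k : ℕ))) =
      if i = j then (N : ℂ) else 0 := by
  have hinv : (starRingEnd ℂ) ζ = ζ⁻¹ :=
    (Complex.inv_eq_conj (hζ.norm'_eq_one hN)).symm
  have hζ0 : ζ ≠ 0 := hζ.ne_zero hN
  have hpow (k : Fin N) : ζ ^ ((i : ℕ) * (k : ℕ)) * (starRingEnd ℂ) (ζ ^ ((j : ℕ) * (k : ℕ))) =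
      (ζ ^ (i : ℕ) * (ζ ^ (j : ℕ))⁻¹) ^ (k : ℕ) := by
    rw [map_pow, hinv, mul_pow, ← pow_mul, inv_pow, inv_pow, ← pow_mul]
  simp_rw [hpow]
  rw [Fin.sum_univ_eq_sum_range (fun k => (ζ ^ (i : ℕ) * (ζ ^ (j : ℕ))⁻¹) ^ k)]
  split_ifs with h
  · subst h
    simp [hζ0]
  · have hne : ζ ^ (i : ℕ) * (ζ ^ (j : ℕ))⁻¹ ≠ 1 := fun h1 =>
      h (Fin.ext (hζ.pow_inj i.2 j.2 ((mul_inv_eq_one₀ (pow_ne_zero _ hζ0)).1 h1)))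
    rw [geom_sum_eq hne, mul_pow, inv_pow, ← pow_mul, ← pow_mul, mul_comm (i : ℕ),
      mul_comm (j : ℕ), pow_mul, pow_mul, hζ.pow_eq_one]
    simp

lemma isPrimitiveRoot_exp_neg {N : ℕ} (hN : N ≠ 0) :
    IsPrimitiveRoot (Complex.exp (-2 * Real.pi * Complex.I / N)) N := by
  have h := (Complex.isPrimitiveRoot_exp N hN).inv
  rwa [← Complex.exp_neg, show -(2 * Real.pi * Complex.I / N : ℂ) = -2 * Real.pi * Complex.I / N by
    ring] at h

lemma sum_normSq_dft {N : ℕ} (hN : N ≠ 0) (x : Fin N → ℂ) :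
    ∑ k, Complex.normSq (dft N x k) = N * ∑ j, Complex.normSq (x j) := by
  apply Complex.ofReal_injective
  push_cast
  simp_rw [← Complex.mul_conj, dft, map_sum, map_mul, Finset.sum_mul_sum]
  rw [Finset.sum_comm, Finset.mul_sum]
  refine Finset.sum_congr rfl fun i _ => ?_
  rw [Finset.sum_comm]
  trans ∑ j : Fin N, x i * (starRingEnd ℂ) (x j) * if i = j then (N : ℂ) else 0
  · refine Finset.sum_congr rfl fun j _ => ?_
    rw [← (isPrimitiveRoot_exp_neg hN).sum_pow_mul_conj_pow hN i j, Finset.mul_sum]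
    exact Finset.sum_congr rfl fun k _ => mul_mul_mul_comm _ _ _ _
  · simp [mul_comm]

/-- The Plancherel identity for the discrete Fourier transform. -/
lemma cnorm_dft {N : ℕ} (hN : N ≠ 0) (x : Fin N → ℂ) :
    cnorm (dft N x) = Real.sqrt N * cnorm x := by
  rw [cnorm, cnorm, sum_normSq_dft hN, Real.sqrt_mul (Nat.cast_nonneg N)]

lemma dft_div_const (N : ℕ) (x : Fin N → ℂ) (a : ℂ) :
    dft N (fun j => x j / a) = fun k => dft N x k / a := by
  funext k
  simp_rw [dft, Finset.sum_div, div_mul_eq_mul_div]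

/-- for real positive constants `c` and `r`,
`F_N(A_{N,c,r}(z)) = F_N(z) / (c + (1/r) ‖F_N(z)‖)` for every `z ∈ ℂ^N`. -/
theorem dft_actG (N : ℕ) (hN : 0 < N) (c r : ℝ) (hc : 0 < c) (hr : 0 < r)
    (z : Fin N → ℂ) :
    dft N (actG N c r z) =
      fun k => dft N z k / ((c + (1 / r) * cnorm (dft N z) : ℝ) : ℂ) := by
  rw [cnorm_dft hN.ne', one_div_mul_eq_div, mul_div_right_comm]
  exact dft_div_const N z _
end

section
/- Back-propagation through the Hadamard layer: let H_[N] be the Hadamard layer with p input channels, q output channels, kernel K ⊆ {0, …, N−1}, weights w_1, …, w_q ∈ ℂ^{|K|×p} and biases b ∈ ℂ^{N×q}, defined by output channels y^j = ∑_{i=1}^{p} z^i · F_N(Pad_N(w_j^i, K)) + b^j. If G : ℂ^{N×q} → ℝ is differentiable in the real sense, then for every input channel i, coordinate k, the Wirtinger derivatives of L = G ∘ H_[N] with respect to the input satisfy ∂L/∂z^i_k = ∑_{j=1}^{q} F_N(Pad_N(w_j^i, K))_k · (∂G/∂z^j_k ∘ H_[N]) and ∂L/∂conj(z^i_k) = ∑_{j=1}^{q}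 conj(F_N(Pad_N(w_j^i, K))_k) · (∂G/∂conj(z^j_k) ∘ H_[N]). -/
open Complex Finset

/-- Zero padding along a kernel: for an (injective) kernel `K : Fin κ → Fin N` and
weights `v ∈ ℂ^κ`, `Pad_N(v, K)` places `v_i` at position `K i` and `0` elsewhere. -/
noncomputable def pad {κ N : ℕ} (K : Fin κ → Fin N) (v : Fin κ → ℂ) : Fin N → ℂ :=
  fun n => ∑ i : Fin κ, if K i = n then v i else 0

/-- The Hadamard layer `H_[N] : ℂ^{N×p} → ℂ^{N×q}` with kernel `K`, weights
`w_1, …, w_q ∈ ℂ^{|K|×p}` and biases `b ∈ ℂ^{N×q}`; a `p`-channel input `z` is sent to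
the `q`-channel output with channels `y^j = ∑_i z^i · F_N(Pad_N(w_j^i, K)) + b^j`,
where `·` is the entrywise (Hadamard) product. Tensors `ℂ^{N×c}` are modelled as
functions `Fin c × Fin N → ℂ`. -/
noncomputable def hadamardLayer {κ N p q : ℕ} (K : Fin κ → Fin N)
    (w : Fin q → Fin κ → Fin p → ℂ) (b : Fin q → Fin N → ℂ)
    (z : Fin p × Fin N → ℂ) : Fin q × Fin N → ℂ :=
  fun jn => (∑ i : Fin p, z (i, jn.2) * dft N (pad K (fun t => w jn.1 t i)) jn.2) + b jn.1 jn.2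

/-- Partial derivative of `f : ℂ^ι → ℂ` with respect to the real part of the
coordinate `z_k`, all other real coordinates held fixed. -/
noncomputable def pdx {ι : Type*} [DecidableEq ι] (f : (ι → ℂ) → ℂ) (z : ι → ℂ) (k : ι) : ℂ :=
  deriv (fun t : ℝ => f (Function.update z k (z k + (t : ℂ)))) 0

/-- Partial derivative of `f : ℂ^ι → ℂ` with respect to the imaginary part of the
coordinate `z_k`, all other real coordinates held fixed. -/
noncomputable def pdy {ι : Type*} [DecidableEq ι] (f : (ι → ℂ) → ℂ) (z : ι → ℂ) (k : ι) : ℂ :=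
  deriv (fun t : ℝ => f (Function.update z k (z k + (t : ℂ) * Complex.I))) 0

/-- Wirtinger derivative `∂f/∂z_k = ½(∂f/∂x_k − i ∂f/∂y_k)`. -/
noncomputable def wirt {ι : Type*} [DecidableEq ι] (f : (ι → ℂ) → ℂ) (z : ι → ℂ) (k : ι) : ℂ :=
  (pdx f z k - Complex.I * pdy f z k) / 2

/-- Conjugate Wirtinger derivative `∂f/∂conj(z_k) = ½(∂f/∂x_k + i ∂f/∂y_k)`. -/
noncomputable def wirtConj {ι : Type*} [DecidableEq ι] (f : (ι → ℂ) → ℂ) (z : ι → ℂ) (k : ι) : ℂ :=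
  (pdx f z k + Complex.I * pdy f z k) / 2

lemma update_add_eq_add_smul_single {ι : Type*} [DecidableEq ι] (z : ι → ℂ) (k : ι) (t : ℝ)
    (c : ℂ) : Function.update z k (z k + t * c) = z + t • (Pi.single k c : ι → ℂ) := by
  ext m
  by_cases h : m = k
  · subst h; simp
  · simp [h]

lemma deriv_ofReal_comp_add_smul {E : Type*} [NormedAddCommGroup E] [NormedSpace ℝ E]
    {G : E → ℝ} {y : E} (hG : DifferentiableAt ℝ G y) (v : E) :
    deriv (fun t : ℝ => ((G (y + t • v) : ℝ) : ℂ)) 0 = (fderiv ℝ G y v : ℝ) :=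
  (hG.hasFDerivAt.hasLineDerivAt v).ofReal_comp.deriv

lemma pdx_ofReal {ι : Type*} [Fintype ι] [DecidableEq ι] {G : (ι → ℂ) → ℝ} {y : ι → ℂ}
    (hG : DifferentiableAt ℝ G y) (k : ι) :
    pdx (fun y => ((G y : ℝ) : ℂ)) y k = (fderiv ℝ G y (Pi.single k 1) : ℝ) := by
  have h (t : ℝ) := update_add_eq_add_smul_single y k t 1
  simp only [mul_one] at h
  simp only [pdx, h, deriv_ofReal_comp_add_smul hG]

lemma pdy_ofReal {ι : Type*} [Fintype ι] [DecidableEq ι] {G : (ι → ℂ) → ℝ} {y : ι → ℂ}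
    (hG : DifferentiableAt ℝ G y) (k : ι) :
    pdy (fun y => ((G y : ℝ) : ℂ)) y k = (fderiv ℝ G y (Pi.single k Complex.I) : ℝ) := by
  simp only [pdy, update_add_eq_add_smul_single, deriv_ofReal_comp_add_smul hG]

lemma hadamardLayer_add_smul_single {κ N p q : ℕ} (K : Fin κ → Fin N)
    (w : Fin q → Fin κ → Fin p → ℂ) (b : Fin q → Fin N → ℂ)
    (z : Fin p × Fin N → ℂ) (i : Fin p) (k : Fin N) (t : ℝ) (c : ℂ) :
    hadamardLayer K w b (z + t • (Pi.single (i, k) c : Fin p × Fin N → ℂ)) = hadamardLayer K w b z +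
      t • ∑ j : Fin q,
        (Pi.single (j, k) (c * dft N (pad K (fun s => w j s i)) k) : Fin q × Fin N → ℂ) := by
  ext ⟨j, n⟩
  by_cases h : n = k
  · subst h
    simp [hadamardLayer, Pi.single_apply, add_mul, Finset.sum_add_distrib, mul_assoc]
    ring
  · simp [hadamardLayer, h]

/-- A real-linear functional on `ℂ^ι`, evaluated on a single coordinate, in terms of its values
on the real and imaginary directions. -/
lemma map_single_eq_re_add_im {ι : Type*} [DecidableEq ι] (D : (ι → ℂ) →L[ℝ] ℝ) (k : ι)
    (c : ℂ) :
    D (Pi.single k c) = c.re * D (Pi.single k 1) + c.im * D (Pi.single k Complex.I) := by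
  have h : (Pi.single k c : ι → ℂ) =
      c.re • (Pi.single k 1 : ι → ℂ) + c.im • (Pi.single k Complex.I : ι → ℂ) := by
    rw [← Pi.single_smul, ← Pi.single_smul, ← Pi.single_add]
    simp [Complex.re_add_im]
  rw [h, map_add, map_smul, map_smul, smul_eq_mul, smul_eq_mul]

/-- back-propagation through the Hadamard layer. Let `H_[N]` be the
Hadamard layer with injective kernel `K`, weights `w` and biases `b`, and let
`G : ℂ^{N×q} → ℝ` be differentiable in the real sense. Then, for every input
channel `i` and coordinate `k`, the Wirtinger derivatives of `L = G ∘ H_[N]` with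
respect to the input satisfy
`∂L/∂z^i_k = ∑_j F_N(Pad_N(w_j^i, K))_k · (∂G/∂z^j_k ∘ H_[N])` and
`∂L/∂conj(z^i_k) = ∑_j conj(F_N(Pad_N(w_j^i, K))_k) · (∂G/∂conj(z^j_k) ∘ H_[N])`. -/
theorem hadamardLayer_backprop {κ N p q : ℕ} (K : Fin κ → Fin N)
    (hK : Function.Injective K)
    (w : Fin q → Fin κ → Fin p → ℂ) (b : Fin q → Fin N → ℂ)
    (G : (Fin q × Fin N → ℂ) → ℝ) (hG : Differentiable ℝ G)
    (z : Fin p × Fin N → ℂ) (i : Fin p) (k : Fin N) :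
    wirt (fun z => ((G (hadamardLayer K w b z) : ℝ) : ℂ)) z (i, k) =
      ∑ j : Fin q, dft N (pad K (fun t => w j t i)) k *
        wirt (fun y => ((G y : ℝ) : ℂ)) (hadamardLayer K w b z) (j, k) ∧
    wirtConj (fun z => ((G (hadamardLayer K w b z) : ℝ) : ℂ)) z (i, k) =
      ∑ j : Fin q, (starRingEnd ℂ) (dft N (pad K (fun t => w j t i)) k) *
        wirtConj (fun y => ((G y : ℝ) : ℂ)) (hadamardLayer K w b z) (j, k) := by
  have hGy := hG (hadamardLayer K w b z)
  set D := fderiv ℝ G (hadamardLayer K w b z) with hD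
  have hx : pdx (fun z => ((G (hadamardLayer K w b z) : ℝ) : ℂ)) z (i, k) =
      ∑ j : Fin q, ((D (Pi.single (j, k) (dft N (pad K (fun t => w j t i)) k)) : ℝ) : ℂ) := by
    have h (t : ℝ) := update_add_eq_add_smul_single z (i, k) t 1
    simp only [mul_one] at h
    simp only [pdx, h, hadamardLayer_add_smul_single, deriv_ofReal_comp_add_smul hGy, ← hD,
      map_sum, one_mul, Complex.ofReal_sum]
  have hy : pdy (fun z => ((G (hadamardLayer K w b z) : ℝ) : ℂ)) z (i, k) =
      ∑ j : Fin q,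
        ((D (Pi.single (j, k) (Complex.I * dft N (pad K (fun t => w j t i)) k)) : ℝ) : ℂ) := by
    simp only [pdy, update_add_eq_add_smul_single, hadamardLayer_add_smul_single,
      deriv_ofReal_comp_add_smul hGy, ← hD, map_sum, Complex.ofReal_sum]
  simp only [wirt, wirtConj, hx, hy, pdx_ofReal hGy, pdy_ofReal hGy, ← hD, Finset.mul_sum,
    ← Finset.sum_sub_distrib, ← Finset.sum_add_distrib, Finset.sum_div]
  constructor <;> refine Finset.sum_congr rfl fun j _ => ?_ <;>
    rw [map_single_eq_re_add_im D _ (dft _ _ _), map_single_eq_re_add_im D _ (Complex.I * _)] <;>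
    apply Complex.ext <;> simp <;> ring
end
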